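/- For all positive integers a, b, c, every type-1 configuration of [a,b,c] admits a proper 8-coloring. -/

import Mathlib

/-- A cuboid with integer root and integer dimensions. -/
structure Cuboid where
  root : ℤ × ℤ × ℤ
  dims : ℤ × ℤ × ℤ
deriving DecidableEq

namespace Cuboid

/-- The dimensions are positive. -/
def valid (C : Cuboid) : Prop :=
  0 < C.dims.1 ∧ 0 < C.dims.2.1 ∧ 0 < C.dims.2.2

/-- The closed cuboid `[x,x+a] × [y,y+b] × [z,z+c] ⊆ ℝ³`. -/
def toSet (C : Cuboid) : Set (ℝ × ℝ × ℝ) :=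
  {p | (C.root.1 : ℝ) ≤ p.1 ∧ p.1 ≤ C.root.1 + C.dims.1 ∧
       (C.root.2.1 : ℝ) ≤ p.2.1 ∧ p.2.1 ≤ C.root.2.1 + C.dims.2.1 ∧
       (C.root.2.2 : ℝ) ≤ p.2.2 ∧ p.2.2 ≤ C.root.2.2 + C.dims.2.2}

/-- The open cuboid `(x,x+a) × (y,y+b) × (z,z+c) ⊆ ℝ³` (the interior). -/
def inte (C : Cuboid) : Set (ℝ × ℝ × ℝ) :=
  {p | (C.root.1 : ℝ) < p.1 ∧ p.1 < C.root.1 + C.dims.1 ∧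
       (C.root.2.1 : ℝ) < p.2.1 ∧ p.2.1 < C.root.2.1 + C.dims.2.1 ∧
       (C.root.2.2 : ℝ) < p.2.2 ∧ p.2.2 < C.root.2.2 + C.dims.2.2}

/-- The set `(ℤ×ℤ×ℝ) ∪ (ℤ×ℝ×ℤ) ∪ (ℝ×ℤ×ℤ)` of grid lines. -/
def grid : Set (ℝ × ℝ × ℝ) :=
  {p | ((∃ m : ℤ, p.1 = m) ∧ (∃ n : ℤ, p.2.1 = n)) ∨
       ((∃ m : ℤ, p.1 = m) ∧ (∃ n : ℤ, p.2.2 = n)) ∨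
       ((∃ m : ℤ, p.2.1 = m) ∧ (∃ n : ℤ, p.2.2 = n))}

/-- Two cuboids collide when their interiors intersect. -/
def Collide (C D : Cuboid) : Prop := (C.inte ∩ D.inte).Nonempty

/-- Two cuboids touch when their interiors are disjoint but their intersection
contains a point outside the grid lines (i.e. it is a non-degenerate rectangle). -/
def Touch (C D : Cuboid) : Prop :=
  ¬ Collide C D ∧ ∃ p ∈ C.toSet ∩ D.toSet, p ∉ grid

end Cuboid

/-- A configuration: a finite family of valid pairwise non-colliding cuboids. -/
def IsConfig (F : Finset Cuboid) : Prop :=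
  (∀ C ∈ F, C.valid) ∧ ∀ C ∈ F, ∀ D ∈ F, C ≠ D → ¬ Cuboid.Collide C D

/-- A type-1 configuration of `[a,b,c]`: every cuboid has dimensions exactly `(a,b,c)`. -/
def Type1 (a b c : ℕ) (F : Finset Cuboid) : Prop :=
  ∀ C ∈ F, C.dims = ((a : ℤ), (b : ℤ), (c : ℤ))

/-- A type-2 configuration of `[a,b,c]`: every cuboid has dimensions `(a,b,c)` or `(b,a,c)`. -/
def Type2 (a b c : ℕ) (F : Finset Cuboid) : Prop :=
  ∀ C ∈ F, C.dims = ((a : ℤ), (b : ℤ), (c : ℤ)) ∨ C.dims = ((b : ℤ), (a : ℤ), (c : ℤ))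

/-- A type-3 configuration of `[a,b,c]`: every cuboid's dimensions are a permutation of `(a,b,c)`. -/
def Type3 (a b c : ℕ) (F : Finset Cuboid) : Prop :=
  ∀ C ∈ F, C.dims = ((a : ℤ), (b : ℤ), (c : ℤ)) ∨ C.dims = ((a : ℤ), (c : ℤ), (b : ℤ)) ∨
    C.dims = ((b : ℤ), (a : ℤ), (c : ℤ)) ∨ C.dims = ((b : ℤ), (c : ℤ), (a : ℤ)) ∨
    C.dims = ((c : ℤ), (a : ℤ), (b : ℤ)) ∨ C.dims = ((c : ℤ), (b : ℤ), (a : ℤ))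

/-- A proper `k`-coloring of a configuration: touching cuboids get distinct colors. -/
def ProperColoring (k : ℕ) (F : Finset Cuboid) : Prop :=
  ∃ κ : Cuboid → Fin k, ∀ C ∈ F, ∀ D ∈ F, Cuboid.Touch C D → κ C ≠ κ D

namespace Cuboid

/-- Parity of the index of the cell of length `n` containing `x`. -/
def cellParity (n x : ℤ) : ℤ := x / n % 2

theorem cellParity_nonneg (n x : ℤ) : 0 ≤ cellParity n x := by
  unfold cellParity; omega

theorem cellParity_lt_two (n x : ℤ) : cellParity n x < 2 := by
  unfold cellParity; omega

theorem cellParity_add_self_ne {n : ℤ} (hn : 0 < n) (x : ℤ) :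
    cellParity n (x + n) ≠ cellParity n x := by
  have h : (x + n) / n = x / n + 1 := by
    simpa using Int.add_mul_ediv_right x 1 hn.ne'
  unfold cellParity
  omega

/-- The color of a cuboid records the parities of the cells containing its root. -/
def parityColor (C : Cuboid) : Fin 8 :=
  ⟨(4 * cellParity C.dims.1 C.root.1 + 2 * cellParity C.dims.2.1 C.root.2.1 +
      cellParity C.dims.2.2 C.root.2.2).toNat, by
    have := cellParity_lt_two C.dims.1 C.root.1
    have := cellParity_lt_two C.dims.2.1 C.root.2.1
    have := cellParity_lt_two C.dims.2.2 C.root.2.2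
    omega⟩

theorem cellParity_eq_of_parityColor_eq {C D : Cuboid} (h : C.parityColor = D.parityColor) :
    cellParity C.dims.1 C.root.1 = cellParity D.dims.1 D.root.1 ∧
    cellParity C.dims.2.1 C.root.2.1 = cellParity D.dims.2.1 D.root.2.1 ∧
    cellParity C.dims.2.2 C.root.2.2 = cellParity D.dims.2.2 D.root.2.2 := by
  simp only [parityColor, Fin.mk.injEq] at h
  have := cellParity_lt_two C.dims.1 C.root.1
  have := cellParity_lt_two C.dims.2.1 C.root.2.1
  have := cellParity_lt_two C.dims.2.2 C.root.2.2
  have := cellParity_lt_two D.dims.1 D.root.1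
  have := cellParity_lt_two D.dims.2.1 D.root.2.1
  have := cellParity_lt_two D.dims.2.2 D.root.2.2
  have := cellParity_nonneg C.dims.1 C.root.1
  have := cellParity_nonneg C.dims.2.1 C.root.2.1
  have := cellParity_nonneg C.dims.2.2 C.root.2.2
  have := cellParity_nonneg D.dims.1 D.root.1
  have := cellParity_nonneg D.dims.2.1 D.root.2.1
  have := cellParity_nonneg D.dims.2.2 D.root.2.2
  omega

theorem cellParity_interval {n x y : ℤ} (hn : 0 < n) (hxy : x ≤ y + n) (hyx : y ≤ x + n)
    (h : cellParity n x = cellParity n y) : x < y + n ∧ y < x + n := by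
  refine ⟨lt_of_le_of_ne hxy ?_, lt_of_le_of_ne hyx ?_⟩
  · rintro rfl
    exact cellParity_add_self_ne hn y h
  · rintro rfl
    exact cellParity_add_self_ne hn x h.symm

/-- Two translates whose roots are at distance less than the dimension in each direction
collide. -/
theorem collide_of_lt {C D : Cuboid} (hd : C.dims = D.dims)
    (h₁ : C.root.1 < D.root.1 + D.dims.1 ∧ D.root.1 < C.root.1 + D.dims.1)
    (h₂ : C.root.2.1 < D.root.2.1 + D.dims.2.1 ∧ D.root.2.1 < C.root.2.1 + D.dims.2.1)
    (h₃ : C.root.2.2 < D.root.2.2 + D.dims.2.2 ∧ D.root.2.2 < C.root.2.2 + D.dims.2.2) :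
    Collide C D := by
  refine ⟨((C.root.1 + D.root.1 + D.dims.1 : ℝ) / 2,
    (C.root.2.1 + D.root.2.1 + D.dims.2.1 : ℝ) / 2,
    (C.root.2.2 + D.root.2.2 + D.dims.2.2 : ℝ) / 2), ?_⟩
  rify at h₁ h₂ h₃
  simp only [inte, Set.mem_inter_iff, Set.mem_ofPred_eq, hd]
  refine ⟨⟨?_, ?_, ?_, ?_, ?_, ?_⟩, ?_, ?_, ?_, ?_, ?_, ?_⟩ <;> linarith

theorem parityColor_ne_of_touch {C D : Cuboid} (hD : D.valid) (hd : C.dims = D.dims)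
    (h : Touch C D) : C.parityColor ≠ D.parityColor := by
  intro hcol
  obtain ⟨hnc, p, ⟨hpC, hpD⟩, -⟩ := h
  obtain ⟨e₁, e₂, e₃⟩ := cellParity_eq_of_parityColor_eq hcol
  obtain ⟨v₁, v₂, v₃⟩ := hD
  simp only [toSet, Set.mem_ofPred_eq] at hpC hpD
  rw [hd] at hpC e₁ e₂ e₃
  obtain ⟨a₁, b₁, a₂, b₂, a₃, b₃⟩ := hpC
  obtain ⟨c₁, d₁, c₂, d₂, c₃, d₃⟩ := hpD
  exact hnc <| collide_of_lt hd
    (cellParity_interval v₁ (mod_cast a₁.trans d₁) (mod_cast c₁.trans b₁) e₁)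
    (cellParity_interval v₂ (mod_cast a₂.trans d₂) (mod_cast c₂.trans b₂) e₂)
    (cellParity_interval v₃ (mod_cast a₃.trans d₃) (mod_cast c₃.trans b₃) e₃)

end Cuboid

/-- For all positive `a, b, c`, every type-1 configuration of `[a,b,c]` admits a proper
8-coloring. -/
theorem type1_8colorable (a b c : ℕ) (ha : 0 < a) (hb : 0 < b) (hc : 0 < c) :
    ∀ F : Finset Cuboid, IsConfig F → Type1 a b c F → ProperColoring 8 F := by
  intro F hF hT
  exact ⟨Cuboid.parityColor, fun C hC D hD h =>
    Cuboid.parityColor_ne_of_touch (hF.1 D hD) ((hT C hC).trans (hT D hD).symm) h⟩
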